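/- arXiv:2602.05674 — 2 statements merged into one kernel-verified Lean document; each statement's English description precedes it below -/
import Mathlib

section
/- (Per-residual reconstruction variance.) For all subsets τ ⊆ γ ⊆ {1,…,d}, every diagonal entry of the matrix T⁺_{τ,γ} V_τ (T⁺_{τ,γ})ᵀ equals v_τ := (∏_{i ∈ τ} (n_i − 1)/n_i) · (∏_{j ∈ γ∖τ} 1/n_j²). (Hence if z_τ = ζ_τ + noise with covariance σ_τ² V_τ, each entry of the reconstructed component T⁺_{τ,γ} z_τ has variance v_τ σ_τ², and the expected squared error of the reconstructed marginal is proportional to ∑_{τ ⊆ γ} v_τ σ_τ².) -/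
open Matrix Finset

/-- Entry of the subtraction matrix `S_ℓ` (0-indexed):
column `0` gives `-1`, column `i+1` gives `1`, all other entries `0`. -/
def sEnt (i j : ℕ) : ℝ := if j = 0 then -1 else if j = i + 1 then 1 else 0

/-- Entry of `S⁺_ℓ`: a zero row stacked on `I_{ℓ-1}`, minus `1/ℓ` everywhere. -/
noncomputable def spEnt (ℓ i j : ℕ) : ℝ :=
  (if i = j + 1 then (1 : ℝ) else 0) - (ℓ : ℝ)⁻¹

/-- Residual index sizes: `n k − 1` for `k ∈ τ`, and `1` otherwise. -/
def rIdx {d : ℕ} (n : Fin d → ℕ) (τ : Finset (Fin d)) (k : Fin d) : ℕ :=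
  if k ∈ τ then n k - 1 else 1

/-- Marginal index sizes: `n k` for `k ∈ γ`, and `1` otherwise. -/
def mIdx {d : ℕ} (n : Fin d → ℕ) (γ : Finset (Fin d)) (k : Fin d) : ℕ :=
  if k ∈ γ then n k else 1

/-- The decomposition matrix `T_{τ,γ} = ⊠_k C_k` with `C_k = S_{n_k}` for
`k ∈ τ`, `C_k = 1ᵀ_{n_k}` (all-ones row) for `k ∈ γ∖τ`, and `C_k = [1]`
for `k ∉ γ`, realized entrywise via the tensor (Kronecker) product. -/
def Tmat {d : ℕ} (n : Fin d → ℕ) (τ γ : Finset (Fin d)) :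
    Matrix (∀ k, Fin (rIdx n τ k)) (∀ k, Fin (mIdx n γ k)) ℝ :=
  Matrix.of fun i j => ∏ k, if k ∈ τ then sEnt (i k) (j k) else (1 : ℝ)

/-- The matrix `T⁺_{τ,γ} = ⊠_k D_k` with `D_k = S⁺_{n_k}` for `k ∈ τ`,
`D_k = (1/n_k)·1_{n_k}` (constant column) for `k ∈ γ∖τ`, and `D_k = [1]`
for `k ∉ γ`. -/
noncomputable def Tpinv {d : ℕ} (n : Fin d → ℕ) (τ γ : Finset (Fin d)) :
    Matrix (∀ k, Fin (mIdx n γ k)) (∀ k, Fin (rIdx n τ k)) ℝ :=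
  Matrix.of fun i j => ∏ k,
    if k ∈ τ then spEnt (n k) (i k) (j k)
    else if k ∈ γ then ((n k : ℝ))⁻¹ else (1 : ℝ)

/-- The marginal query matrix `M_γ = ⊠_k E_k` with `E_k = I_{n_k}` for
`k ∈ γ` and `E_k = 1ᵀ_{n_k}` otherwise. -/
def Mmat {d : ℕ} (n : Fin d → ℕ) (γ : Finset (Fin d)) :
    Matrix (∀ k, Fin (mIdx n γ k)) (∀ k, Fin (n k)) ℝ :=
  Matrix.of fun i j => ∏ k,
    if k ∈ γ then (if (i k : ℕ) = (j k : ℕ) then (1 : ℝ) else 0) else (1 : ℝ)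

/-- The residual query matrix `R_τ = ⊠_k F_k` with `F_k = S_{n_k}` for
`k ∈ τ` and `F_k = 1ᵀ_{n_k}` otherwise. -/
def Rmat {d : ℕ} (n : Fin d → ℕ) (τ : Finset (Fin d)) :
    Matrix (∀ k, Fin (rIdx n τ k)) (∀ k, Fin (n k)) ℝ :=
  Matrix.of fun i j => ∏ k, if k ∈ τ then sEnt (i k) (j k) else (1 : ℝ)

theorem matrix_of_prod_mul_of_prod {R ι : Type*} [CommSemiring R] [Fintype ι] [DecidableEq ι]
    {l m o : ι → Type*} [∀ k, Fintype (m k)]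
    (A : ∀ k, l k → m k → R) (B : ∀ k, m k → o k → R) :
    (Matrix.of fun (i : ∀ k, l k) (j : ∀ k, m k) => ∏ k, A k (i k) (j k)) *
        (Matrix.of fun (i : ∀ k, m k) (j : ∀ k, o k) => ∏ k, B k (i k) (j k)) =
      Matrix.of fun i j => ∏ k, ∑ x, A k (i k) x * B k x (j k) := by
  ext i j
  simp only [Matrix.mul_apply, Matrix.of_apply, ← Finset.prod_mul_distrib,
    Finset.prod_univ_sum, Fintype.piFinset_univ]

/-- `S⁺_ℓ S_ℓ` is the centering matrix `I - (1/ℓ) J`. -/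
theorem sum_spEnt_mul_sEnt {ℓ i j : ℕ} (hi : i < ℓ) (hj : j < ℓ) :
    ∑ x ∈ range (ℓ - 1), spEnt ℓ i x * sEnt x j = (if i = j then 1 else 0) - (ℓ : ℝ)⁻¹ := by
  obtain ⟨m, rfl⟩ : ∃ m, ℓ = m + 1 := ⟨ℓ - 1, by omega⟩
  simp only [Nat.add_sub_cancel, sEnt]
  rcases j with _ | j
  · have hm : (m : ℝ) + 1 ≠ 0 := by positivity
    simp only [if_true, mul_neg, mul_one, spEnt, Finset.sum_neg_distrib, Finset.sum_sub_distrib,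
      Finset.sum_const, Finset.card_range, nsmul_eq_mul]
    rcases i with _ | i
    · simp
      field_simp
      ring
    · have him : i < m := by omega
      simp [him]
      field_simp
      ring
  · have hjm : j < m := by omega
    simp [spEnt, hjm]

/-- The squared norm of a row of the centering matrix `I - (1/ℓ) J`. -/
theorem sum_centering_sq {ℓ i : ℕ} (hi : i < ℓ) :
    ∑ j ∈ range ℓ, ((if i = j then (1 : ℝ) else 0) - (ℓ : ℝ)⁻¹) ^ 2 = ((ℓ : ℝ) - 1) / ℓ := by
  have hℓ : (ℓ : ℝ) ≠ 0 := Nat.cast_ne_zero.mpr (by omega)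
  have h : ∀ j, ((if i = j then (1 : ℝ) else 0) - (ℓ : ℝ)⁻¹) ^ 2 =
      (if i = j then 1 - 2 * (ℓ : ℝ)⁻¹ else 0) + (ℓ : ℝ)⁻¹ ^ 2 := by
    intro j
    split_ifs <;> ring
  simp only [h, Finset.sum_add_distrib, Finset.sum_ite_eq, Finset.mem_range, hi, if_true,
    Finset.sum_const, Finset.card_range, nsmul_eq_mul]
  field_simp
  ring

/-- The product `T⁺_{τ,γ} T_{τ,τ}`, computed factor by factor. -/
theorem Tpinv_mul_Tmat {d : ℕ} (n : Fin d → ℕ) {τ γ : Finset (Fin d)} (hτγ : τ ⊆ γ) :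
    Tpinv n τ γ * Tmat n τ τ = Matrix.of fun i j => ∏ k,
      if k ∈ τ then (if (i k : ℕ) = (j k : ℕ) then (1 : ℝ) else 0) - (n k : ℝ)⁻¹
      else if k ∈ γ then (n k : ℝ)⁻¹ else 1 := by
  unfold Tpinv Tmat
  rw [matrix_of_prod_mul_of_prod
    (fun k (i : Fin (mIdx n γ k)) (j : Fin (rIdx n τ k)) =>
      if k ∈ τ then spEnt (n k) i j else if k ∈ γ then (n k : ℝ)⁻¹ else 1)
    (fun k (i : Fin (rIdx n τ k)) (j : Fin (mIdx n τ k)) =>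
      if k ∈ τ then sEnt i j else 1)]
  ext i j
  simp only [Matrix.of_apply]
  refine Finset.prod_congr rfl fun k _ => ?_
  rw [Fin.sum_univ_eq_sum_range (fun x =>
    (if k ∈ τ then spEnt (n k) (i k) x else if k ∈ γ then (n k : ℝ)⁻¹ else 1) *
      if k ∈ τ then sEnt x (j k) else 1)]
  by_cases hk : k ∈ τ
  · have hi : (i k : ℕ) < n k := by simpa [mIdx, hτγ hk] using (i k).isLt
    have hj : (j k : ℕ) < n k := by simpa [mIdx, hk] using (j k).isLt
    simpa [hk, rIdx] using sum_spEnt_mul_sEnt hi hj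
  · simp [hk, rIdx]

/-- (Per-residual reconstruction variance.) For all `τ ⊆ γ ⊆ {1,…,d}`, every
diagonal entry of `T⁺_{τ,γ} V_τ (T⁺_{τ,γ})ᵀ` equals
`v_τ = (∏_{i ∈ τ} (n_i − 1)/n_i) · (∏_{j ∈ γ∖τ} 1/n_j²)`,
where `V_τ := T_{τ,τ} T_{τ,τ}ᵀ`. -/
theorem reconstruction_variance (d : ℕ) (hd : 1 ≤ d) (n : Fin d → ℕ)
    (hn : ∀ k, 2 ≤ n k) (τ γ : Finset (Fin d)) (hτγ : τ ⊆ γ) :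
    ∀ i : ∀ k, Fin (mIdx n γ k),
      (Tpinv n τ γ * (Tmat n τ τ * (Tmat n τ τ)ᵀ) * (Tpinv n τ γ)ᵀ) i i =
        (∏ a ∈ τ, ((n a : ℝ) - 1) / (n a : ℝ)) *
          ∏ b ∈ γ \ τ, ((n b : ℝ) ^ 2)⁻¹ := by
  intro i
  rw [← Matrix.mul_assoc, Matrix.mul_assoc, ← Matrix.transpose_mul, Tpinv_mul_Tmat n hτγ]
  simp only [Matrix.mul_apply, Matrix.transpose_apply, Matrix.of_apply, ← sq,
    ← Finset.prod_pow]
  rw [← Fintype.piFinset_univ, ← Finset.prod_univ_sum (fun _ => Finset.univ)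
    (fun k (x : Fin (mIdx n τ k)) =>
      (if k ∈ τ then (if (i k : ℕ) = (x : ℕ) then (1 : ℝ) else 0) - (n k : ℝ)⁻¹
        else if k ∈ γ then (n k : ℝ)⁻¹ else 1) ^ 2)]
  rw [← Finset.prod_subset (Finset.subset_univ γ), ← Finset.prod_sdiff hτγ, mul_comm]
  · congr 1 <;> refine Finset.prod_congr rfl fun k hk => ?_
    · have hi : (i k : ℕ) < n k := by simpa [mIdx, hτγ hk] using (i k).isLt
      rw [← sum_centering_sq hi, Fin.sum_univ_eq_sum_range (fun x =>
        (if k ∈ τ then (if (i k : ℕ) = x then (1 : ℝ) else 0) - (n k : ℝ)⁻¹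
          else if k ∈ γ then (n k : ℝ)⁻¹ else 1) ^ 2)]
      simp [mIdx, hk]
    · obtain ⟨hkγ, hkτ⟩ := Finset.mem_sdiff.mp hk
      simp only [hkτ, if_false]
      rw [Finset.sum_const, Finset.card_univ, Fintype.card_fin]
      simp [hkγ, hkτ, mIdx]
  · intro k _ hk
    have hkτ : k ∉ τ := fun h => hk (hτγ h)
    simp only [hkτ, if_false]
    rw [Finset.sum_const, Finset.card_univ, Fintype.card_fin]
    simp [hk, hkτ, mIdx]
end

section
/- (GReM-MLE consistency.) For any family of residual vectors (z_τ)_{τ ⊆ {1,…,d}}, one for each subset τ of {1,…,d}, there exists a unique data vector Â ∈ ℝ^{∏_k n_k} such that R_τ Â = z_τ for every τ ⊆ {1,…,d}; moreover, for every subset γ ⊆ {1,…,d}, the γ-marginal of this data vector satisfies M_γ Â = ∑_{τ ⊆ γ} T⁺_{τ,γ} z_τ. Hence the marginal estimates produced by GReM-MLE reconstruction are mutually consistent with a common data array. -/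
open Matrix Finset

/-- `S_ℓ S⁺_ℓ = I`, entrywise. -/
lemma sum_sEnt_mul_spEnt {n i j : ℕ} (hi : i < n - 1) :
    ∑ x ∈ range n, sEnt i x * spEnt n x j = if i = j then 1 else 0 := by
  have h : ∀ x, sEnt i x * spEnt n x j =
      (if x = i + 1 then spEnt n (i + 1) j else 0) - (if x = 0 then spEnt n 0 j else 0) := by
    intro x
    unfold sEnt
    rcases eq_or_ne x 0 with rfl | h0
    · simp
    · by_cases h1 : x = i + 1 <;> simp [h0, h1]
  have hi' : i + 1 < n := by omega
  have hn : 0 < n := by omega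
  simp_rw [h]
  simp [Finset.sum_sub_distrib, hi', hn, spEnt]

/-- The rows of `S_ℓ` sum to zero. -/
lemma sum_sEnt {n i : ℕ} (hi : i < n - 1) : ∑ x ∈ range n, sEnt i x = 0 := by
  have h : ∀ x, sEnt i x = (if x = i + 1 then 1 else 0) - (if x = 0 then 1 else 0) := by
    intro x
    unfold sEnt
    rcases eq_or_ne x 0 with rfl | h0
    · simp
    · by_cases h1 : x = i + 1 <;> simp [h0, h1]
  have hi' : i + 1 < n := by omega
  have hn : 0 < n := by omega
  simp [h, Finset.sum_sub_distrib, hi', hn]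

/-- The columns of `S⁺_ℓ` sum to zero. -/
lemma sum_spEnt {n j : ℕ} (hj : j < n - 1) : ∑ x ∈ range n, spEnt n x j = 0 := by
  have hj' : j + 1 < n := by omega
  have hn : (n : ℝ) ≠ 0 := by
    have : n ≠ 0 := by omega
    exact_mod_cast this
  simp [spEnt, Finset.sum_sub_distrib, hj', hn]

/-- `S⁺_ℓ S_ℓ + (1/ℓ) 1 1ᵀ = I`, entrywise. -/
lemma sum_spEnt_mul_sEnt_add {n i j : ℕ} (hi : i < n) (hj : j < n) :
    ∑ x ∈ range (n - 1), spEnt n i x * sEnt x j + (n : ℝ)⁻¹ = if i = j then 1 else 0 := by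
  obtain ⟨m, rfl⟩ : ∃ m, n = m + 1 := ⟨n - 1, by omega⟩
  have hm : ((m : ℝ) + 1) ≠ 0 := by positivity
  rcases j with _ | j
  · rcases i with _ | i
    · simp [sEnt, spEnt]
      field_simp
    · have hi' : i < m := by omega
      simp [sEnt, spEnt, Finset.sum_sub_distrib, hi']
      field_simp
      ring
  · have hj' : j < m := by omega
    simp [sEnt, spEnt, hj']

/-- Mixed-product property of entrywise tensor products. -/
lemma sum_prod_mul_prod {d : ℕ} (m : Fin d → ℕ) (f g : Fin d → ℕ → ℝ) :
    ∑ x : ∀ k, Fin (m k), (∏ k, f k (x k)) * ∏ k, g k (x k) =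
      ∏ k, ∑ x ∈ range (m k), f k x * g k x := by
  simp_rw [← Finset.prod_mul_distrib, Finset.sum_range]
  exact (Fintype.prod_sum fun k (x : Fin (m k)) => f k x * g k x).symm

/-- The pseudoinverse `⊠_k D_k` of `R_τ`, with `D_k = S⁺_{n_k}` for `k ∈ τ` and
`D_k = (1/n_k)·1_{n_k}` otherwise. -/
noncomputable def Rpinv {d : ℕ} (n : Fin d → ℕ) (τ : Finset (Fin d)) :
    Matrix (∀ k, Fin (n k)) (∀ k, Fin (rIdx n τ k)) ℝ :=
  Matrix.of fun i j => ∏ k, if k ∈ τ then spEnt (n k) (i k) (j k) else ((n k : ℝ))⁻¹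

lemma lt_of_mem_rIdx {d : ℕ} {n : Fin d → ℕ} {τ : Finset (Fin d)} {k : Fin d} (hk : k ∈ τ)
    (i : Fin (rIdx n τ k)) : (i : ℕ) < n k - 1 := by
  simpa [rIdx, hk] using i.isLt

lemma lt_of_mem_mIdx {d : ℕ} {n : Fin d → ℕ} {γ : Finset (Fin d)} {k : Fin d} (hk : k ∈ γ)
    (i : Fin (mIdx n γ k)) : (i : ℕ) < n k := by
  simpa [mIdx, hk] using i.isLt

lemma Rmat_mul_Rpinv_self {d : ℕ} (n : Fin d → ℕ) (hn : ∀ k, n k ≠ 0) (τ : Finset (Fin d)) :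
    Rmat n τ * Rpinv n τ = 1 := by
  ext i j
  have hn' (k : Fin d) : (n k : ℝ) ≠ 0 := Nat.cast_ne_zero.2 (hn k)
  have hfac (k : Fin d) :
      ∑ x ∈ range (n k), (if k ∈ τ then sEnt (i k) x else 1) *
        (if k ∈ τ then spEnt (n k) x (j k) else (n k : ℝ)⁻¹) =
      if i k = j k then 1 else 0 := by
    by_cases hk : k ∈ τ
    · simp only [hk, if_true]
      rw [sum_sEnt_mul_spEnt (lt_of_mem_rIdx hk _)]
      simp [Fin.ext_iff]
    · have hi := (i k).isLt
      have hj := (j k).isLt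
      have h1 : rIdx n τ k = 1 := by simp [rIdx, hk]
      have hij : i k = j k := Fin.ext (by omega)
      simp [hk, hij, hn']
  simp only [Matrix.mul_apply, Rmat, Rpinv, Matrix.of_apply]
  rw [sum_prod_mul_prod n (fun k x => if k ∈ τ then sEnt (i k) x else 1)
    (fun k x => if k ∈ τ then spEnt (n k) x (j k) else (n k : ℝ)⁻¹)]
  simp_rw [hfac, Finset.prod_boole, Matrix.one_apply, funext_iff]
  simp

lemma Rmat_mul_Rpinv_of_ne {d : ℕ} (n : Fin d → ℕ) {τ σ : Finset (Fin d)} (h : τ ≠ σ) :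
    Rmat n τ * Rpinv n σ = 0 := by
  ext i j
  simp only [Matrix.mul_apply, Rmat, Rpinv, Matrix.of_apply, Matrix.zero_apply]
  rw [sum_prod_mul_prod n (fun k x => if k ∈ τ then sEnt (i k) x else 1)
    (fun k x => if k ∈ σ then spEnt (n k) x (j k) else (n k : ℝ)⁻¹)]
  obtain ⟨k, hk⟩ : ∃ k, ¬ (k ∈ τ ↔ k ∈ σ) := by
    by_contra! hc
    exact h (Finset.ext hc)
  refine Finset.prod_eq_zero (Finset.mem_univ k) ?_
  by_cases hτ : k ∈ τ
  · have hσ : k ∉ σ := by tauto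
    simp only [hτ, hσ, if_true, if_false]
    rw [← Finset.sum_mul, sum_sEnt (lt_of_mem_rIdx hτ _), zero_mul]
  · have hσ : k ∈ σ := by tauto
    simp only [hτ, hσ, if_true, if_false, one_mul]
    exact sum_spEnt (lt_of_mem_rIdx hσ _)

lemma Mmat_mul_Rpinv_of_subset {d : ℕ} (n : Fin d → ℕ) (hn : ∀ k, n k ≠ 0)
    {τ γ : Finset (Fin d)} (h : τ ⊆ γ) : Mmat n γ * Rpinv n τ = Tpinv n τ γ := by
  ext i j
  have hn' (k : Fin d) : (n k : ℝ) ≠ 0 := Nat.cast_ne_zero.2 (hn k)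
  simp only [Matrix.mul_apply, Mmat, Rpinv, Tpinv, Matrix.of_apply]
  rw [sum_prod_mul_prod n (fun k x => if k ∈ γ then (if (i k : ℕ) = x then 1 else 0) else 1)
    (fun k x => if k ∈ τ then spEnt (n k) x (j k) else (n k : ℝ)⁻¹)]
  refine Finset.prod_congr rfl fun k _ => ?_
  by_cases hγ : k ∈ γ
  · have hi := lt_of_mem_mIdx hγ (i k)
    simp [hγ, hi]
  · have hτ : k ∉ τ := fun hk => hγ (h hk)
    simp [hγ, hτ, hn']

lemma Mmat_mul_Rpinv_of_not_subset {d : ℕ} (n : Fin d → ℕ)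
    {τ γ : Finset (Fin d)} (h : ¬ τ ⊆ γ) : Mmat n γ * Rpinv n τ = 0 := by
  ext i j
  simp only [Matrix.mul_apply, Mmat, Rpinv, Matrix.of_apply, Matrix.zero_apply]
  rw [sum_prod_mul_prod n (fun k x => if k ∈ γ then (if (i k : ℕ) = x then 1 else 0) else 1)
    (fun k x => if k ∈ τ then spEnt (n k) x (j k) else (n k : ℝ)⁻¹)]
  obtain ⟨k, hτ, hγ⟩ := Finset.not_subset.1 h
  refine Finset.prod_eq_zero (Finset.mem_univ k) ?_
  simp only [hτ, hγ, if_true, if_false, one_mul]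
  exact sum_spEnt (lt_of_mem_rIdx hτ _)

lemma sum_Rpinv_mul_Rmat {d : ℕ} (n : Fin d → ℕ) :
    ∑ τ : Finset (Fin d), Rpinv n τ * Rmat n τ = 1 := by
  ext i j
  have hfac (τ : Finset (Fin d)) : (Rpinv n τ * Rmat n τ) i j =
      (∏ k ∈ τ, ∑ x ∈ range (n k - 1), spEnt (n k) (i k) x * sEnt x (j k)) *
        ∏ k ∈ univ \ τ, (n k : ℝ)⁻¹ := by
    simp only [Matrix.mul_apply, Rmat, Rpinv, Matrix.of_apply]
    rw [sum_prod_mul_prod (rIdx n τ)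
      (fun k x => if k ∈ τ then spEnt (n k) (i k) x else (n k : ℝ)⁻¹)
      (fun k x => if k ∈ τ then sEnt x (j k) else 1),
      ← Finset.prod_sdiff (Finset.subset_univ τ), mul_comm]
    congr 1
    · exact Finset.prod_congr rfl fun k hk => by simp [rIdx, hk]
    · refine Finset.prod_congr rfl fun k hk => ?_
      have hk' : k ∉ τ := (Finset.mem_sdiff.1 hk).2
      simp [rIdx, hk']
  rw [Matrix.sum_apply]
  simp_rw [hfac]
  rw [← Finset.powerset_univ, ← Finset.prod_add]
  simp_rw [sum_spEnt_mul_sEnt_add (i _).isLt (j _).isLt, Finset.prod_boole, Matrix.one_apply,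
    funext_iff, Fin.ext_iff]
  simp

/-- (GReM-MLE consistency.) For any family of residual vectors
`(z_τ)_{τ ⊆ {1,…,d}}` there exists a unique data vector `Â` with
`R_τ Â = z_τ` for every `τ`; moreover for every `γ ⊆ {1,…,d}` its
`γ`-marginal satisfies `M_γ Â = ∑_{τ ⊆ γ} T⁺_{τ,γ} z_τ`. -/
theorem grem_mle_consistency (d : ℕ) (hd : 1 ≤ d) (n : Fin d → ℕ)
    (hn : ∀ k, 2 ≤ n k)
    (z : (τ : Finset (Fin d)) → ((∀ k, Fin (rIdx n τ k)) → ℝ)) :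
    ∃ A : (∀ k, Fin (n k)) → ℝ,
      (∀ τ : Finset (Fin d), Rmat n τ *ᵥ A = z τ) ∧
      (∀ γ : Finset (Fin d),
        Mmat n γ *ᵥ A = ∑ τ ∈ γ.powerset, Tpinv n τ γ *ᵥ z τ) ∧
      (∀ A' : (∀ k, Fin (n k)) → ℝ,
        (∀ τ : Finset (Fin d), Rmat n τ *ᵥ A' = z τ) → A' = A) := by
  have hn0 (k : Fin d) : n k ≠ 0 := by have := hn k; omega
  refine ⟨∑ τ, Rpinv n τ *ᵥ z τ, fun τ => ?_, fun γ => ?_, fun A' hA' => ?_⟩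
  · rw [Matrix.mulVec_sum, Finset.sum_eq_single τ]
    · rw [Matrix.mulVec_mulVec, Rmat_mul_Rpinv_self n hn0, Matrix.one_mulVec]
    · intro σ _ hσ
      rw [Matrix.mulVec_mulVec, Rmat_mul_Rpinv_of_ne n hσ.symm, Matrix.zero_mulVec]
    · simp
  · rw [Matrix.mulVec_sum, ← Finset.sum_subset (Finset.subset_univ γ.powerset)]
    · refine Finset.sum_congr rfl fun τ hτ => ?_
      rw [Matrix.mulVec_mulVec, Mmat_mul_Rpinv_of_subset n hn0 (Finset.mem_powerset.1 hτ)]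
    · intro τ _ hτ
      rw [Matrix.mulVec_mulVec,
        Mmat_mul_Rpinv_of_not_subset n (fun h => hτ (Finset.mem_powerset.2 h)),
        Matrix.zero_mulVec]
  · simp_rw [← hA', Matrix.mulVec_mulVec]
    rw [← Matrix.sum_mulVec, sum_Rpinv_mul_Rmat, Matrix.one_mulVec]
end
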